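/- arXiv:1902.09185 — 2 statements merged into one kernel-verified Lean document; each statement's English description precedes it below -/
import Mathlib

section
/- Let A be an artin algebra and I an injective A-module such that A embeds in an exact sequence 0 → A → I⁰ → I¹ with I⁰, I¹ ∈ add I (i.e., A ∈ Sub²(I)). If X is an A-module with projective dimension at most 1, then the injective hull of X belongs to add I; in particular X embeds into a module of add I. -/
open CategoryTheory TensorProduct

universe u

/-- The `k`-th Ext group of the `A`-modules `X` and `Y`. -/
noncomputable def ExtGrp (A : Type u) [Ring A] (k : ℕ)
    (X Y : Type u) [AddCommGroup X] [Module A X] [AddCommGroup Y] [Module A Y] : Type u :=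
  ((Ext ℤ (ModuleCat.{u} A) k).obj (Opposite.op (ModuleCat.of A X))).obj (ModuleCat.of A Y)

noncomputable instance (A : Type u) [Ring A] (k : ℕ)
    (X Y : Type u) [AddCommGroup X] [Module A X] [AddCommGroup Y] [Module A Y] :
    AddCommGroup (ExtGrp A k X Y) := by
  unfold ExtGrp; infer_instance

/-- `Ext_A^k(X, Y) = 0`. -/
def ExtZero (A : Type u) [Ring A] (k : ℕ)
    (X Y : Type u) [AddCommGroup X] [Module A X] [AddCommGroup Y] [Module A Y] : Prop :=
  Subsingleton (ExtGrp A k X Y)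

/-- `pd X ≤ n`: `Ext^k(X, -)` vanishes for all `k > n`. -/
def ProjDimLE (A : Type u) [Ring A] (X : Type u) [AddCommGroup X] [Module A X] (n : ℕ) : Prop :=
  ∀ k : ℕ, n < k → ∀ Y : ModuleCat.{u} A, ExtZero A k X Y

/-- The projective dimension of `X`, the length of a shortest projective resolution,
as an element of `ℕ∞` (`⊤` if infinite). -/
noncomputable def projDim (A : Type u) [Ring A] (X : Type u) [AddCommGroup X] [Module A X] : ℕ∞ :=
  sInf ((fun n : ℕ => (n : ℕ∞)) '' {n : ℕ | ProjDimLE A X n})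

/-- `id Y ≤ n`: `Ext^k(-, Y)` vanishes for all `k > n`. -/
def InjDimLE (A : Type u) [Ring A] (Y : Type u) [AddCommGroup Y] [Module A Y] (n : ℕ) : Prop :=
  ∀ k : ℕ, n < k → ∀ X : ModuleCat.{u} A, ExtZero A k X Y

/-- The injective dimension of `Y`, as an element of `ℕ∞` (`⊤` if infinite). -/
noncomputable def injDim (A : Type u) [Ring A] (Y : Type u) [AddCommGroup Y] [Module A Y] : ℕ∞ :=
  sInf ((fun n : ℕ => (n : ℕ∞)) '' {n : ℕ | InjDimLE A Y n})

/-- `X ∈ add Q`: `X` is a direct summand of a finite direct sum of copies of `Q`. -/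
def InAdd (A : Type u) [Ring A] (Q : Type u) [AddCommGroup Q] [Module A Q]
    (X : Type u) [AddCommGroup X] [Module A X] : Prop :=
  ∃ (n : ℕ) (Y : ModuleCat.{u} A), Nonempty ((X × Y) ≃ₗ[A] (Fin n → Q))

/-- `f : M → I` is an injective hull: `I` is an injective module and `f` is an essential
monomorphism. -/
def IsInjHull (A : Type u) [Ring A] {M I : Type u} [AddCommGroup M] [Module A M]
    [AddCommGroup I] [Module A I] (f : M →ₗ[A] I) : Prop :=
  Module.Injective A I ∧ Function.Injective f ∧
    ∀ N : Submodule A I, N ≠ ⊥ → N ⊓ LinearMap.range f ≠ ⊥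

section Helpers

theorem hasPD_of_projDim (A : Type u) [Ring A] (X : Type u) [AddCommGroup X] [Module A X]
    (hX : projDim A X ≤ (1 : ℕ∞)) : HasProjectiveDimensionLT (ModuleCat.of A X) 2 := by
  have h1 : ∃ n : ℕ, n ≤ 1 ∧ ProjDimLE A X n := by
    by_contra! hcon
    have : (2 : ℕ∞) ≤ projDim A X := by
      refine le_sInf ?_
      rintro _ ⟨n, hn, rfl⟩
      by_contra! hlt
      have : n < 2 := by exact_mod_cast hlt
      exact hcon n (by omega) hn
    have := this.trans hX
    exact absurd this (by decide)
  obtain ⟨n, hn, hP⟩ := h1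
  let R : ProjectiveResolution (ModuleCat.of A X) := projectiveResolution _
  rw [hasProjectiveDimensionLT_iff.{u}]
  intro i hi Y e
  obtain ⟨f, hf, rfl⟩ := R.extMk_surjective e (i + 1) rfl
  obtain ⟨p, rfl⟩ : ∃ p, i = p + 1 := ⟨i - 1, by omega⟩
  rw [R.extMk_eq_zero_iff f _ rfl hf p rfl]
  have hsub : Subsingleton (((Ext ℤ (ModuleCat.{u} A) (p + 1)).obj
    (Opposite.op (ModuleCat.of A X))).obj Y) := hP (p + 1) (by omega) Y
  have hz := (ModuleCat.isZero_of_subsingleton _).of_iso (R.isoExt (R := ℤ) (p + 1) Y).symm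
  rw [← HomologicalComplex.exactAt_iff_isZero_homology,
    HomologicalComplex.exactAt_iff' _ p (p + 1) (p + 1 + 1) (by simp) (by simp),
    ShortComplex.moduleCat_exact_iff] at hz
  obtain ⟨g, hg⟩ := hz f hf
  exact ⟨g, hg⟩

theorem ker_projective (A : Type u) [Ring A] (X : Type u) [AddCommGroup X] [Module A X]
    (hX : projDim A X ≤ (1 : ℕ∞)) (P : Type u) [AddCommGroup P] [Module A P]
    [Module.Projective A P] (π : P →ₗ[A] X) (hπ : Function.Surjective π) :
    Module.Projective A (LinearMap.ker π) := by
  have h2 := hasPD_of_projDim A X hX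
  let S : ShortComplex (ModuleCat.{u} A) :=
    ShortComplex.mk (ModuleCat.ofHom (LinearMap.ker π).subtype) (ModuleCat.ofHom π) (by
      ext x; exact x.2)
  have hS : S.ShortExact := ModuleCat.shortComplex_shortExact S
    (by
      intro y
      constructor
      · intro hy; exact ⟨⟨y, hy⟩, rfl⟩
      · rintro ⟨x, rfl⟩; exact x.2) (LinearMap.ker π).injective_subtype hπ
  have hP : Projective (ModuleCat.of A P) := (IsProjective.iff_projective P).1 inferInstance
  have hS1 := hS.hasProjectiveDimensionLT_X₁ 1
    (show HasProjectiveDimensionLT (ModuleCat.of A P) 1 from inferInstance) h2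
  rw [IsProjective.iff_projective]
  exact projective_iff_hasProjectiveDimensionLT_one.2 hS1

/-- `M` embeds in a finite power of `I`. -/
def Cog (A : Type u) [Ring A] (I : Type u) [AddCommGroup I] [Module A I]
    (M : Type u) [AddCommGroup M] [Module A M] : Prop :=
  ∃ (n : ℕ) (φ : M →ₗ[A] (Fin n → I)), Function.Injective φ

variable {A : Type u} [Ring A] {I : Type u} [AddCommGroup I] [Module A I]
  {M N : Type u} [AddCommGroup M] [Module A M] [AddCommGroup N] [Module A N]

theorem Cog.of_finite {ι : Type} [Finite ι] (φ : M →ₗ[A] (ι → I)) (h : Function.Injective φ) :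
    Cog A I M := by
  obtain ⟨n, ⟨e⟩⟩ := Finite.exists_equiv_fin ι
  refine ⟨n, (LinearEquiv.funCongrLeft A I e.symm).toLinearMap ∘ₗ φ, ?_⟩
  exact (LinearEquiv.funCongrLeft A I e.symm).injective.comp h

theorem Cog.prod (hM : Cog A I M) (hN : Cog A I N) : Cog A I (M × N) := by
  obtain ⟨n, φ, hφ⟩ := hM
  obtain ⟨m, ψ, hψ⟩ := hN
  refine Cog.of_finite (ι := Fin n ⊕ Fin m)
    ((LinearEquiv.sumArrowLequivProdArrow (Fin n) (Fin m) A I).symm.toLinearMap ∘ₗ φ.prodMap ψ) ?_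
  refine (LinearEquiv.sumArrowLequivProdArrow (Fin n) (Fin m) A I).symm.injective.comp ?_
  exact Function.Injective.prodMap hφ hψ

theorem Cog.pow (hM : Cog A I M) (k : ℕ) : Cog A I (Fin k → M) := by
  obtain ⟨n, φ, hφ⟩ := hM
  refine Cog.of_finite (ι := Fin k × Fin n)
    (LinearMap.pi fun p => LinearMap.proj p.2 ∘ₗ φ ∘ₗ LinearMap.proj p.1) ?_
  intro x y hxy
  ext i
  apply hφ
  ext j
  exact congrFun hxy (i, j)

theorem InAdd.cog (h : InAdd A I M) : Cog A I M := by
  obtain ⟨n, Y, ⟨e⟩⟩ := h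
  exact ⟨n, e.toLinearMap ∘ₗ LinearMap.inl A M Y, e.injective.comp LinearMap.inl_injective⟩

theorem InAdd.inj (hI : Module.Injective A I) (h : InAdd A I M) : Module.Injective A M := by
  obtain ⟨n, Y, ⟨e⟩⟩ := h
  refine ⟨fun P Q _ _ _ _ f hf g => ?_⟩
  obtain ⟨k, hk⟩ := Module.Injective.extension_property A (Fin n → I) P Q f hf
    (e.toLinearMap ∘ₗ LinearMap.inl A M Y ∘ₗ g)
  refine ⟨LinearMap.fst A M Y ∘ₗ e.symm.toLinearMap ∘ₗ k, fun x => ?_⟩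
  have := LinearMap.congr_fun hk x
  simp only [LinearMap.comp_apply] at this
  simp [this]

end Helpers

/-- Let `A` be an artin algebra and `I` an injective module such that there
is an exact sequence `0 → A → I⁰ → I¹` with `I⁰, I¹ ∈ add I` (i.e. `A ∈ Sub²(I)`). If `X` is
a (finitely generated) module of projective dimension at most `1`, then the injective hull of
`X` belongs to `add I`; in particular `X` embeds into a module of `add I`. -/
theorem stmt18 (R₀ : Type u) [CommRing R₀] [IsArtinianRing R₀]
    (A : Type u) [Ring A] [Algebra R₀ A] [Module.Finite R₀ A]
    (I : Type u) [AddCommGroup I] [Module A I] (hI : Module.Injective A I)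
    (I0 I1 : Type u) [AddCommGroup I0] [Module A I0] [AddCommGroup I1] [Module A I1]
    (hI0 : InAdd A I I0) (hI1 : InAdd A I I1)
    (f0 : A →ₗ[A] I0) (g0 : I0 →ₗ[A] I1)
    (hmono : Function.Injective f0) (hexact : Function.Exact f0 g0)
    (X : Type u) [AddCommGroup X] [Module A X] [Module.Finite A X]
    (hX : projDim A X ≤ (1 : ℕ∞)) :
    (∀ (E : Type u) [AddCommGroup E] [Module A E] (h : X →ₗ[A] E),
        IsInjHull A h → InAdd A I E) ∧
      ∃ (n : ℕ) (φ : X →ₗ[A] (Fin n → I)), Function.Injective φ := by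
  have hJ0 := hI0.inj hI
  have main : Cog A I X := by
    have hR : IsNoetherian R₀ A := isNoetherian_of_isNoetherianRing_of_finite R₀ A
    have hA : IsNoetherianRing A := isNoetherian_of_tower R₀ hR
    obtain ⟨n, π, hπ⟩ := Module.Finite.exists_fin' A X
    have hproj := ker_projective A X hX (Fin n → A) π hπ
    obtain ⟨m, q, hq⟩ := Module.Finite.exists_fin' A (LinearMap.ker π)
    obtain ⟨σ, hσ⟩ := Module.projective_lifting_property q LinearMap.id hq
    have hσ' : ∀ p, q (σ p) = p := fun p => LinearMap.congr_fun hσ p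
    have hF : ∀ k : ℕ, Function.Injective (f0.compLeft (Fin k)) := fun k x y hxy => by
      ext i
      exact hmono (congrFun hxy i)
    let u : LinearMap.ker π →ₗ[A] (Fin m → I0) := f0.compLeft (Fin m) ∘ₗ σ
    have hu : Function.Injective u :=
      (hF m).comp (Function.LeftInverse.injective hσ')
    obtain ⟨ext0, hext0⟩ := Module.Injective.extension_property A (Fin m → I0) _ _
      (f0.compLeft (Fin m)) (hF m) (f0.compLeft (Fin m) ∘ₗ (LinearMap.id - σ ∘ₗ q))
    have hext0' : ∀ a, ext0 (f0.compLeft (Fin m) a) = f0.compLeft (Fin m) (a - σ (q a)) :=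
      fun a => LinearMap.congr_fun hext0 a
    let g : (Fin m → I0) →ₗ[A] (Fin m → I1) × (Fin m → I0) := (g0.compLeft (Fin m)).prod ext0
    have hgu : ∀ p, g (u p) = 0 := by
      intro p
      refine Prod.ext ?_ ?_
      · ext i
        exact (hexact _).2 ⟨_, rfl⟩
      · change ext0 (f0.compLeft (Fin m) (σ p)) = 0
        rw [hext0', hσ', sub_self, map_zero]
    have hgk : ∀ y, g y = 0 → ∃ p, u p = y := by
      intro y hy
      have h1 : ∀ i, ∃ a, f0 a = y i := fun i =>
        (hexact _).1 (congrFun (congrArg Prod.fst hy) i)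
      choose a ha using h1
      have hy' : f0.compLeft (Fin m) a = y := funext ha
      have h2 : ext0 y = 0 := congrArg Prod.snd hy
      rw [← hy', hext0'] at h2
      have h3 : a - σ (q a) = 0 := hF m (h2.trans (map_zero _).symm)
      refine ⟨q a, ?_⟩
      change f0.compLeft (Fin m) (σ (q a)) = y
      rw [← sub_eq_zero.1 h3, hy']
    let v : (Fin n → A) →ₗ[A] (Fin n → I0) := f0.compLeft (Fin n)
    let w : LinearMap.ker π →ₗ[A] (Fin n → I0) := v ∘ₗ (LinearMap.ker π).subtype
    have hw : Function.Injective w := (hF n).comp (LinearMap.ker π).injective_subtype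
    obtain ⟨t, ht⟩ := Module.Injective.extension_property A (Fin m → I0) _ _ w hw u
    obtain ⟨s, hs⟩ := Module.Injective.extension_property A (Fin n → I0) _ _ u hu w
    have ht' : ∀ p, t (w p) = u p := fun p => LinearMap.congr_fun ht p
    have hs' : ∀ p, s (u p) = w p := fun p => LinearMap.congr_fun hs p
    let Φ : (Fin n → A) →ₗ[A] (Fin n → I0) × ((Fin m → I1) × (Fin m → I0)) :=
      (v - s ∘ₗ t ∘ₗ v).prod (g ∘ₗ t ∘ₗ v)
    have hΦ : LinearMap.ker Φ = LinearMap.ker π := by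
      ext x
      constructor
      · intro hx
        have h1 : v x - s (t (v x)) = 0 := congrArg Prod.fst hx
        have h2 : g (t (v x)) = 0 := congrArg Prod.snd hx
        obtain ⟨p, hp⟩ := hgk _ h2
        rw [← hp, hs', sub_eq_zero] at h1
        have h3 : x = p := hF n h1
        rw [h3]
        exact p.2
      · intro hx
        have h0 : v x = w ⟨x, hx⟩ := rfl
        refine Prod.ext ?_ ?_
        · change v x - s (t (v x)) = 0
          rw [h0, ht', hs', sub_self]
        · change g (t (v x)) = 0
          rw [h0, ht', hgu]
    have hcog : Cog A I ((Fin n → I0) × ((Fin m → I1) × (Fin m → I0))) :=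
      (hI0.cog.pow n).prod ((hI1.cog.pow m).prod (hI0.cog.pow m))
    obtain ⟨N, ψ, hψ⟩ := hcog
    let Ψ := (LinearMap.ker π).liftQ Φ hΦ.ge
    have hΨ : Function.Injective Ψ := by
      rw [← LinearMap.ker_eq_bot]
      exact Submodule.ker_liftQ_eq_bot _ _ _ hΦ.le
    let e := π.quotKerEquivOfSurjective hπ
    exact ⟨N, ψ ∘ₗ Ψ ∘ₗ e.symm.toLinearMap, hψ.comp (hΨ.comp e.symm.injective)⟩
  refine ⟨?_, main⟩
  intro E _ _ h ⟨hE, hinj, hess⟩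
  obtain ⟨n, φ, hφ⟩ := main
  obtain ⟨k, hk⟩ := Module.Injective.extension_property A (Fin n → I) _ _ h hinj φ
  have hk' : ∀ x, k (h x) = φ x := fun x => LinearMap.congr_fun hk x
  have hkinj : LinearMap.ker k = ⊥ := by
    by_contra hne
    refine hess _ hne ?_
    rw [eq_bot_iff]
    rintro _ ⟨hy, x, rfl⟩
    have h1 : φ x = 0 := by rw [← hk']; exact hy
    have h2 : x = 0 := hφ (h1.trans (map_zero _).symm)
    simp [h2]
  obtain ⟨r, hr⟩ := Module.Injective.extension_property A E _ _ k
    (LinearMap.ker_eq_bot.1 hkinj) LinearMap.id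
  have hr' : ∀ x, r (k x) = x := fun x => LinearMap.congr_fun hr x
  refine ⟨n, ModuleCat.of A (LinearMap.ker r), ⟨LinearEquiv.ofBijective
    (k.coprod (LinearMap.ker r).subtype) ⟨?_, ?_⟩⟩⟩
  · rw [injective_iff_map_eq_zero]
    rintro ⟨x, y⟩ hxy
    have hxy' : k x + (y : Fin n → I) = 0 := hxy
    have hy : r (y : Fin n → I) = 0 := y.2
    have hx : x = 0 := by
      have := congrArg r hxy'
      rwa [map_add, hr', hy, add_zero, map_zero] at this
    subst hx
    rw [map_zero, zero_add] at hxy'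
    exact Prod.ext rfl (Subtype.ext hxy')
  · intro y
    refine ⟨(r y, ⟨y - k (r y), ?_⟩), ?_⟩
    · rw [LinearMap.mem_ker, map_sub, hr', sub_self]
    · change k (r y) + (y - k (r y)) = y
      abel
end

section
/- Let A be an artin algebra and P a projective A-module such that the injective cogenerator DA admits an exact sequence P₁ → P₀ → DA → 0 with P₀, P₁ ∈ add P (i.e., DA ∈ Fac₂(P)). If Y is an A-module with injective dimension at most 1, then the projective cover of Y belongs to add P; in particular Y is a quotient of a module in add P. -/
open CategoryTheory TensorProduct

universe u

/-- `g : P → Y` is a projective cover: `P` is projective, `g` is surjective, and `ker g` is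
superfluous in `P`. -/
def IsProjCover (A : Type u) [Ring A] {P Y : Type u} [AddCommGroup P] [Module A P]
    [AddCommGroup Y] [Module A Y] (g : P →ₗ[A] Y) : Prop :=
  Module.Projective A P ∧ Function.Surjective g ∧
    ∀ N : Submodule A P, N ⊔ LinearMap.ker g = ⊤ → N = ⊤

section Helpers

open CategoryTheory Limits

lemma hasInjDimLT_two_of_injDim (A : Type u) [Ring A] (Y : Type u) [AddCommGroup Y] [Module A Y]
    (hY : injDim A Y ≤ (1 : ℕ∞)) : HasInjectiveDimensionLT (ModuleCat.of A Y) 2 := by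
  have h2 : ∀ X : ModuleCat.{u} A, ExtZero A 2 X Y := by
    have hne : ((fun n : ℕ => (n : ℕ∞)) '' {n : ℕ | InjDimLE A Y n}).Nonempty := by
      by_contra hne
      rw [Set.not_nonempty_iff_eq_empty] at hne
      rw [injDim, hne, sInf_empty] at hY
      simp at hY
    obtain ⟨n, hn, hn'⟩ := csInf_mem hne
    have hle : n ≤ 1 := by
      have h3 : (n : ℕ∞) ≤ 1 := by
        have : (n : ℕ∞) = injDim A Y := hn'
        rw [this]; exact hY
      exact_mod_cast h3
    exact fun X => hn 2 (by omega) X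
  apply hasInjectiveDimensionLT_of_enoughProjectives.{u}
  intro X
  refine subsingleton_of_forall_eq 0 fun α => ?_
  let P := projectiveResolution X
  obtain ⟨f, hf, rfl⟩ := P.extMk_surjective α 3 rfl
  rw [P.extMk_eq_zero_iff f 3 rfl hf 1 rfl]
  have hsub : Subsingleton (((Ext ℤ (ModuleCat.{u} A) 2).obj (Opposite.op X)).obj
      (ModuleCat.of A Y)) := h2 X
  have hz : IsZero ((P.complex.linearYonedaObj ℤ (ModuleCat.of A Y)).homology 2) :=
    IsZero.of_iso (ModuleCat.isZero_of_subsingleton _) (P.isoExt 2 (ModuleCat.of A Y)).symm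
  rw [← HomologicalComplex.exactAt_iff_isZero_homology,
    HomologicalComplex.exactAt_iff' _ 1 2 3 (by simp) (by simp),
    ShortComplex.moduleCat_exact_iff] at hz
  obtain ⟨g, hg⟩ := hz f hf
  exact ⟨g, hg⟩

/-- The cokernel of an embedding of a module of injective dimension `≤ 1` into an injective
module is injective. -/
lemma injective_quotient (A : Type u) [Ring A] (Y : Type u) [AddCommGroup Y] [Module A Y]
    (hY : HasInjectiveDimensionLT (ModuleCat.of A Y) 2)
    (I : Type u) [AddCommGroup I] [Module A I] (hI : Module.Injective A I)
    (j : Y →ₗ[A] I) (hj : Function.Injective j) :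
    Module.Injective A (I ⧸ LinearMap.range j) := by
  let S : ShortComplex (ModuleCat.{u} A) :=
    ShortComplex.mk (ModuleCat.ofHom j) (ModuleCat.ofHom (LinearMap.range j).mkQ) (by
      ext y
      simp)
  have hS : S.ShortExact := by
    refine { exact := ?_, mono_f := ?_, epi_g := ?_ }
    · rw [ShortComplex.moduleCat_exact_iff]
      intro x hx
      have hx' : (LinearMap.range j).mkQ x = 0 := hx
      rw [Submodule.mkQ_apply, Submodule.Quotient.mk_eq_zero] at hx'
      exact hx'
    · exact (ModuleCat.mono_iff_injective _).2 hj
    · exact (ModuleCat.epi_iff_surjective _).2 (Submodule.mkQ_surjective _)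
  have hI' : Injective S.X₂ := (Module.injective_iff_injective_object A I).1 hI
  have h1 : HasInjectiveDimensionLT S.X₃ 1 :=
    (hS.hasInjectiveDimensionLT_X₃_iff 0 hI').2 hY
  exact (Module.injective_iff_injective_object A _).2
    (injective_iff_hasInjectiveDimensionLT_one.2 h1)

lemma hom_zero_of_inAdd {A : Type u} [Ring A] {P Q S : Type u} [AddCommGroup P] [Module A P]
    [AddCommGroup Q] [Module A Q] [AddCommGroup S] [Module A S] (hQ : InAdd A P Q)
    (h : ∀ f : P →ₗ[A] S, f = 0) (f : Q →ₗ[A] S) : f = 0 := by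
  obtain ⟨n, Y, ⟨e⟩⟩ := hQ
  have h1 : f ∘ₗ LinearMap.fst A Q Y ∘ₗ e.symm.toLinearMap = 0 := by
    apply LinearMap.pi_ext'
    intro i
    rw [h ((f ∘ₗ LinearMap.fst A Q Y ∘ₗ e.symm.toLinearMap) ∘ₗ LinearMap.single A (fun _ => P) i)]
    simp
  ext q
  have := LinearMap.congr_fun h1 (e (q, 0))
  simpa using this

lemma projective_pi_fin {A : Type u} [Ring A] {P : Type u} [AddCommGroup P] [Module A P]
    (hP : Module.Projective A P) (n : ℕ) : Module.Projective A (Fin n → P) :=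
  Module.Projective.of_equiv (DFinsupp.linearEquivFunOnFintype (R := A) (M := fun _ : Fin n => P))

lemma projective_of_inAdd {A : Type u} [Ring A] {P Q : Type u} [AddCommGroup P] [Module A P]
    [AddCommGroup Q] [Module A Q] (hP : Module.Projective A P) (hQ : InAdd A P Q) :
    Module.Projective A Q := by
  obtain ⟨n, Y, ⟨e⟩⟩ := hQ
  have := projective_pi_fin hP n
  refine Module.Projective.of_split (e.toLinearMap ∘ₗ LinearMap.inl A Q Y)
    (LinearMap.fst A Q Y ∘ₗ e.symm.toLinearMap) ?_
  ext q
  simp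

lemma pi_hom_zero {A : Type u} [Ring A] {Q S : Type u} [AddCommGroup Q] [Module A Q]
    [AddCommGroup S] [Module A S] {n : ℕ}
    (h : ∀ f : Q →ₗ[A] S, f = 0) (f : (Fin n → Q) →ₗ[A] S) : f = 0 := by
  apply LinearMap.pi_ext'
  intro i
  rw [h (f ∘ₗ LinearMap.single A (fun _ => Q) i)]
  simp

/-- Coordinatewise application of a linear map. -/
def powMap {A : Type u} [Ring A] {Q S : Type u} [AddCommGroup Q] [Module A Q]
    [AddCommGroup S] [Module A S] (n : ℕ) (f : Q →ₗ[A] S) : (Fin n → Q) →ₗ[A] (Fin n → S) :=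
  LinearMap.pi fun i => f ∘ₗ LinearMap.proj i

lemma powMap_surjective {A : Type u} [Ring A] {Q S : Type u} [AddCommGroup Q] [Module A Q]
    [AddCommGroup S] [Module A S] (n : ℕ) (f : Q →ₗ[A] S) (hf : Function.Surjective f) :
    Function.Surjective (powMap n f) := by
  intro y
  choose x hx using fun i => hf (y i)
  exact ⟨x, funext hx⟩

/-- Key vanishing: if `Hom(P, S) = 0` then `Hom(Y, S) = 0`. -/
lemma hom_zero_key {A : Type u} [Ring A]
    (P : Type u) [AddCommGroup P] [Module A P] (hP : Module.Projective A P)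
    (C : Type u) [AddCommGroup C] [Module A C] [Module.Finite A C]
    (hCinj : Module.Injective A C)
    (hCcogen : ∀ M : ModuleCat.{u} A, Module.Finite A M →
      ∃ (n : ℕ) (φ : ↥M →ₗ[A] (Fin n → C)), Function.Injective φ)
    (P0 P1 : Type u) [AddCommGroup P0] [Module A P0] [AddCommGroup P1] [Module A P1]
    (hP0 : InAdd A P P0) (hP1 : InAdd A P P1)
    (p1 : P1 →ₗ[A] P0) (p0 : P0 →ₗ[A] C)
    (hepi : Function.Surjective p0) (hexact : Function.Exact p1 p0)
    (Y : Type u) [AddCommGroup Y] [Module A Y] [Module.Finite A Y]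
    (hY : injDim A Y ≤ (1 : ℕ∞))
    (S : Type u) [AddCommGroup S] [Module A S] (hS : ∀ f : P →ₗ[A] S, f = 0)
    (f : Y →ₗ[A] S) : f = 0 := by
  obtain ⟨n, j, hj⟩ := hCcogen (ModuleCat.of A Y) ‹_›
  change Y →ₗ[A] (Fin n → C) at j
  have hCn : Module.Injective A (Fin n → C) := by
    refine ⟨fun X Z _ _ _ _ a ha b => ?_⟩
    choose c hc using fun i => hCinj.out a ha (LinearMap.proj i ∘ₗ b)
    exact ⟨LinearMap.pi c, fun x => funext fun i => hc i x⟩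
  have hI1 := injective_quotient A Y (hasInjDimLT_two_of_injDim A Y hY) _ hCn j hj
  obtain ⟨m, i, hi⟩ := hCcogen (ModuleCat.of A ((Fin n → C) ⧸ LinearMap.range j))
    (inferInstanceAs (Module.Finite A ((Fin n → C) ⧸ LinearMap.range j)))
  change ((Fin n → C) ⧸ LinearMap.range j) →ₗ[A] (Fin m → C) at i
  obtain ⟨r, hr⟩ := hI1.out i hi LinearMap.id
  have hP0p := projective_of_inAdd hP hP0
  have hP0n := projective_pi_fin hP0p n
  have hP0m := projective_pi_fin hP0p m
  have hP0S : ∀ g : P0 →ₗ[A] S, g = 0 := hom_zero_of_inAdd hP0 hS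
  have hP1S : ∀ g : P1 →ₗ[A] S, g = 0 := hom_zero_of_inAdd hP1 hS
  obtain ⟨h, hh⟩ := Module.projective_lifting_property (LinearMap.range j).mkQ
    (r ∘ₗ powMap m p0) (Submodule.mkQ_surjective _)
  obtain ⟨t, ht⟩ := Module.projective_lifting_property (powMap m p0)
    (i ∘ₗ (LinearMap.range j).mkQ ∘ₗ powMap n p0) (powMap_surjective m p0 hepi)
  -- elements of the range of `j` come from `Y`
  let jE : Y ≃ₗ[A] LinearMap.range j := LinearEquiv.ofInjective j hj
  have hjE : ∀ y, (jE.symm ⟨j y, y, rfl⟩) = y := fun y => by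
    rw [LinearEquiv.symm_apply_eq]; rfl
  have hK : ∀ w : Fin m → P1, h (powMap m p1 w) ∈ LinearMap.range j := fun w => by
    rw [← Submodule.Quotient.mk_eq_zero, ← Submodule.mkQ_apply]
    have := LinearMap.congr_fun hh (powMap m p1 w)
    rw [LinearMap.comp_apply] at this
    rw [this, LinearMap.comp_apply]
    have h0 : powMap m p0 (powMap m p1 w) = 0 := funext fun k => hexact.apply_apply_eq_zero (w k)
    rw [h0, map_zero]
  have hD : ∀ w : Fin n → P0, (powMap n p0 - h ∘ₗ t) w ∈ LinearMap.range j := fun w => by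
    rw [← Submodule.Quotient.mk_eq_zero, ← Submodule.mkQ_apply, LinearMap.sub_apply, map_sub,
      sub_eq_zero]
    have h1 := LinearMap.congr_fun hh (t w)
    have h2 := LinearMap.congr_fun ht w
    simp only [LinearMap.comp_apply] at h1 h2
    rw [LinearMap.comp_apply, h1, h2, hr]
    rfl
  have z1 := pi_hom_zero hP1S
    (f ∘ₗ jE.symm.toLinearMap ∘ₗ (h ∘ₗ powMap m p1).codRestrict (LinearMap.range j) hK)
  have z2 := pi_hom_zero hP0S
    (f ∘ₗ jE.symm.toLinearMap ∘ₗ (powMap n p0 - h ∘ₗ t).codRestrict (LinearMap.range j) hD)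
  ext y
  obtain ⟨w, hw⟩ := powMap_surjective n p0 hepi (j y)
  have h3 : powMap m p0 (t w) = 0 := by
    have h2 := LinearMap.congr_fun ht w
    simp only [LinearMap.comp_apply] at h2
    rw [h2, hw]
    have : (LinearMap.range j).mkQ (j y) = 0 := by
      rw [Submodule.mkQ_apply, Submodule.Quotient.mk_eq_zero]; exact ⟨y, rfl⟩
    rw [this, map_zero]
  choose v hv using fun k => (hexact (t w k)).1 (congrFun h3 k)
  have hv' : powMap m p1 v = t w := funext hv
  have e1 := LinearMap.congr_fun z1 v
  have e2 := LinearMap.congr_fun z2 w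
  simp only [LinearMap.comp_apply, LinearMap.zero_apply, LinearEquiv.coe_coe] at e1 e2
  have e3 := congrArg₂ (· + ·) e1 e2
  simp only [← map_add, add_zero] at e3
  have e4 : (LinearMap.codRestrict (LinearMap.range j) (h ∘ₗ powMap m p1) hK v +
      LinearMap.codRestrict (LinearMap.range j) (powMap n p0 - h ∘ₗ t) hD w) =
      ⟨j y, y, rfl⟩ := by
    apply Subtype.ext
    simp [hv', hw]
  rw [e4, hjE] at e3
  simpa using e3

end Helpers

/-- dual of Statement 18. Let `A` be an artin algebra, `P` a projective
module, and `C` the minimal injective cogenerator `DA` (formalized as a finitely generated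
injective module into a finite power of which every finitely generated module embeds).
Assume there is an exact sequence `P₁ → P₀ → C → 0` with `P₀, P₁ ∈ add P`
(i.e. `DA ∈ Fac₂(P)`). If `Y` is a (finitely generated) module of injective dimension at
most `1`, then the projective cover of `Y` belongs to `add P`; in particular `Y` is a
quotient of a module in `add P`. -/
theorem stmt19 (R₀ : Type u) [CommRing R₀] [IsArtinianRing R₀]
    (A : Type u) [Ring A] [Algebra R₀ A] [Module.Finite R₀ A]
    (P : Type u) [AddCommGroup P] [Module A P] (hP : Module.Projective A P)
    (C : Type u) [AddCommGroup C] [Module A C] [Module.Finite A C]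
    (hCinj : Module.Injective A C)
    (hCcogen : ∀ M : ModuleCat.{u} A, Module.Finite A M →
      ∃ (n : ℕ) (φ : ↥M →ₗ[A] (Fin n → C)), Function.Injective φ)
    (P0 P1 : Type u) [AddCommGroup P0] [Module A P0] [AddCommGroup P1] [Module A P1]
    (hP0 : InAdd A P P0) (hP1 : InAdd A P P1)
    (p1 : P1 →ₗ[A] P0) (p0 : P0 →ₗ[A] C)
    (hepi : Function.Surjective p0) (hexact : Function.Exact p1 p0)
    (Y : Type u) [AddCommGroup Y] [Module A Y] [Module.Finite A Y]
    (hY : injDim A Y ≤ (1 : ℕ∞)) :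
    (∀ (Pc : Type u) [AddCommGroup Pc] [Module A Pc] (g : Pc →ₗ[A] Y),
        IsProjCover A g → InAdd A P Pc) ∧
      ∃ (n : ℕ) (ψ : (Fin n → P) →ₗ[A] Y), Function.Surjective ψ := by
  have key : ∃ (n : ℕ) (ψ : (Fin n → P) →ₗ[A] Y), Function.Surjective ψ := by
    let T : Submodule A Y := ⨆ f : P →ₗ[A] Y, LinearMap.range f
    have hS : ∀ f : P →ₗ[A] (Y ⧸ T), f = 0 := by
      intro f
      obtain ⟨g, hg⟩ := Module.projective_lifting_property T.mkQ f (Submodule.mkQ_surjective _)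
      rw [← hg]
      ext x
      rw [LinearMap.comp_apply, Submodule.mkQ_apply, LinearMap.zero_apply,
        Submodule.Quotient.mk_eq_zero]
      exact (le_iSup (fun f : P →ₗ[A] Y => LinearMap.range f) g) ⟨x, rfl⟩
    have h0 : T.mkQ = 0 := hom_zero_key P hP C hCinj hCcogen P0 P1 hP0 hP1 p1 p0 hepi hexact
      Y hY _ hS T.mkQ
    have hT : T = ⊤ := by
      rw [← Submodule.ker_mkQ T, h0, LinearMap.ker_zero]
    have hc : IsCompactElement (⊤ : Submodule A Y) :=
      (Submodule.fg_iff_compact _).1 Module.Finite.fg_top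
    obtain ⟨s, hs⟩ := (CompleteLattice.isCompactElement_iff_exists_le_iSup_of_le_iSup _).1 hc _
      (fun f : P →ₗ[A] Y => LinearMap.range f) hT.ge
    let e := s.equivFin
    refine ⟨s.card, LinearMap.lsum A _ ℕ fun k => (e.symm k : P →ₗ[A] Y), ?_⟩
    rw [← LinearMap.range_eq_top, eq_top_iff]
    refine hs.trans (Finset.sup_le fun f hf => ?_)
    rintro _ ⟨x, rfl⟩
    refine ⟨Pi.single (e ⟨f, hf⟩) x, ?_⟩
    simp only [LinearMap.lsum_apply, LinearMap.sum_apply, LinearMap.comp_apply,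
      LinearMap.proj_apply]
    rw [Finset.sum_eq_single (e ⟨f, hf⟩)]
    · simp
    · intro b _ hb
      rw [Pi.single_eq_of_ne hb, map_zero]
    · simp
  refine ⟨?_, key⟩
  intro Pc _ _ g ⟨hproj, hsurj, hsup⟩
  obtain ⟨n, ψ, hψ⟩ := key
  have hPn := projective_pi_fin hP n
  obtain ⟨l, hl⟩ := Module.projective_lifting_property g ψ hsurj
  have hlt : LinearMap.range l = ⊤ := by
    apply hsup
    rw [eq_top_iff]
    intro x _
    obtain ⟨w, hw⟩ := hψ (g x)
    rw [← hl, LinearMap.comp_apply] at hw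
    rw [Submodule.mem_sup]
    exact ⟨l w, ⟨w, rfl⟩, x - l w, by simp [hw], by simp⟩
  obtain ⟨σ, hσ⟩ := Module.projective_lifting_property l LinearMap.id
    (LinearMap.range_eq_top.1 hlt)
  have hσ' : ∀ x, l (σ x) = x := fun x => LinearMap.congr_fun hσ x
  refine ⟨n, ModuleCat.of A (LinearMap.ker l), ⟨?_⟩⟩
  refine LinearEquiv.ofBijective
    (M := Pc × LinearMap.ker l)
    (LinearMap.coprod σ (LinearMap.ker l).subtype) ⟨?_, ?_⟩
  · rw [← LinearMap.ker_eq_bot, LinearMap.ker_eq_bot']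
    rintro ⟨x, k, hk⟩ hx
    simp only [LinearMap.coprod_apply, Submodule.subtype_apply] at hx
    have h1 := congrArg l hx
    rw [map_add, hσ', LinearMap.mem_ker.1 hk, add_zero, map_zero] at h1
    subst h1
    rw [map_zero, zero_add] at hx
    subst hx
    rfl
  · intro w
    exact ⟨(l w, ⟨w - σ (l w), by simp [hσ']⟩), by simp⟩
end
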